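/- There exists a valuation v ∈ L^{IL_p} with v(p ∨ ¬p) = F for an atom p; hence the law of excluded middle p ∨ ¬p is not a tautology of the RNmatrix R(M_{IL_p}) = ⟨L^{IL_p}, M_{IL_p}⟩. -/

import Mathlib

/-- Formulas of intuitionistic propositional logic. -/
inductive IForm : Type where
  | atom : ℕ → IForm
  | bot : IForm
  | top : IForm
  | neg : IForm → IForm
  | imp : IForm → IForm → IForm
  | conj : IForm → IForm → IForm
  | disj : IForm → IForm → IForm
deriving DecidableEq

/-- Multifunction for negation in `M_{ILp}`: `¬̃F = {F, T}`, `¬̃T = {F}`.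
(`true` is the value `T`, `false` is `F`.) -/
def INeg : Bool → Set Bool
  | false => Set.univ
  | true => {false}

/-- Multifunction for implication in `M_{ILp}`. -/
def IImp : Bool → Bool → Set Bool
  | false, false => Set.univ
  | false, true => {true}
  | true, false => {false}
  | true, true => {true}

/-- `v ∈ Val(M_{ILp})`. -/
def IIsVal (v : IForm → Bool) : Prop :=
  v IForm.bot = false ∧ v IForm.top = true ∧
  (∀ a, v (IForm.neg a) ∈ INeg (v a)) ∧
  (∀ a b, v (IForm.imp a b) ∈ IImp (v a) (v b)) ∧
  (∀ a b, v (IForm.conj a b) = (v a && v b)) ∧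
  (∀ a b, v (IForm.disj a b) = (v a || v b))

/-- The levels `L_k` of valuations of `M_{ILp}`. -/
def ILev : ℕ → Set (IForm → Bool)
  | 0 => {v | IIsVal v}
  | k + 1 => {v | v ∈ ILev k ∧
      (∀ a b, v a = false → v b = false → v (IForm.imp a b) = false →
        ∃ w ∈ ILev k, w a = true ∧ w b = false ∧ ∀ c, v c = true → w c = true) ∧
      (∀ a, v a = false → v (IForm.neg a) = false →
        ∃ w ∈ ILev k, w a = true ∧ ∀ c, v c = true → w c = true)}

/-- `L^{ILp} = ⋂_k L_k`, the restricted set of valuations of the RNmatrix for `ILp`. -/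
def ILimit : Set (IForm → Bool) := {v | ∀ k, v ∈ ILev k}

/-- The classical valuation making every atom true: the forcing relation at the upper world of
the two-element Kripke chain. -/
def IForm.upperWorld : IForm → Bool
  | .atom _ => true
  | .bot => false
  | .top => true
  | .neg a => !a.upperWorld
  | .imp a b => !a.upperWorld || b.upperWorld
  | .conj a b => a.upperWorld && b.upperWorld
  | .disj a b => a.upperWorld || b.upperWorld

/-- The forcing relation at the root of the two-element Kripke chain, where no atom is forced. -/
def IForm.root : IForm → Bool
  | .atom _ => false
  | .bot => false
  | .top => true
  | .neg a => !a.upperWorld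
  | .imp a b => (!a.root || b.root) && (!a.upperWorld || b.upperWorld)
  | .conj a b => a.root && b.root
  | .disj a b => a.root || b.root

/-- Forcing is persistent along the two-element chain. -/
theorem IForm.upperWorld_of_root {a : IForm} (h : a.root = true) : a.upperWorld = true := by
  induction a <;> simp_all [IForm.root, IForm.upperWorld]
  tauto

theorem IForm.isVal_upperWorld : IIsVal IForm.upperWorld := by
  refine ⟨rfl, rfl, fun a => ?_, fun a b => ?_, fun _ _ => rfl, fun _ _ => rfl⟩
  · cases h : a.upperWorld <;> simp [INeg, IForm.upperWorld, h]
  · cases ha : a.upperWorld <;> cases hb : b.upperWorld <;>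
      simp [IImp, IForm.upperWorld, ha, hb]

theorem IForm.isVal_root : IIsVal IForm.root := by
  refine ⟨rfl, rfl, fun a => ?_, fun a b => ?_, fun _ _ => rfl, fun _ _ => rfl⟩
  · cases h : a.root
    · simp [INeg]
    · simp [INeg, IForm.root, upperWorld_of_root h]
  · cases ha : a.root <;> cases hb : b.root
    · simp [IImp]
    · simp [IImp, IForm.root, ha, upperWorld_of_root hb]
    · simp [IImp, IForm.root, ha, hb]
    · simp [IImp, IForm.root, hb, upperWorld_of_root hb]

theorem IForm.upperWorld_mem_ILimit : IForm.upperWorld ∈ ILimit := by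
  intro k
  induction k with
  | zero => exact isVal_upperWorld
  | succ k ih =>
    refine ⟨ih, fun a b ha _ hab => ?_, fun a ha hna => ?_⟩
    · simp [IForm.upperWorld, ha] at hab
    · simp [IForm.upperWorld, ha] at hna

theorem IForm.root_mem_ILimit : IForm.root ∈ ILimit := by
  intro k
  induction k with
  | zero => exact isVal_root
  | succ k ih =>
    refine ⟨ih, fun a b ha _ hab => ?_, fun a _ hna => ?_⟩
    · have h : a.upperWorld = true ∧ b.upperWorld = false := by
        simpa [IForm.root, ha] using hab
      exact ⟨_, upperWorld_mem_ILimit k, h.1, h.2, fun _ => upperWorld_of_root⟩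
    · have h : a.upperWorld = true := by simpa [IForm.root] using hna
      exact ⟨_, upperWorld_mem_ILimit k, h, fun _ => upperWorld_of_root⟩

theorem excluded_middle_not_tautology_of_RNmatrix_ILp (p : ℕ) :
    (∃ v ∈ ILimit, v (IForm.disj (IForm.atom p) (IForm.neg (IForm.atom p))) = false) ∧
    ¬ (∀ v ∈ ILimit, v (IForm.disj (IForm.atom p) (IForm.neg (IForm.atom p))) = true) := by
  have h : IForm.root (.disj (.atom p) (.neg (.atom p))) = false := rfl
  refine ⟨⟨_, IForm.root_mem_ILimit, h⟩, fun H => ?_⟩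
  simpa [h] using H _ IForm.root_mem_ILimit
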